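/- Let T₀ ⊆ {1,…,n} be nonempty with |T₀| = F₀, let H be a symmetric real n×n matrix with ‖H‖ ≤ F₀, and let a, x ∈ ℝⁿ be supported in T₀ with a ≠ 0 and ‖(1−c)a + cx‖₂ ≥ ‖a‖₂ for all c ∈ [0,1]. Write F(y) = (yᵀHy)/(yᵀy) and let 0 < ε < 1. If |F(a) − 1| ≤ ε/2 and ‖x − a‖₁ ≤ ε·‖a‖₁/(8·F₀^{3/2}), then |F(x) − 1| ≤ ε. -/

import Mathlib

open scoped RealInnerProductSpace

/-- A Rayleigh quotient of a bounded symmetric operator is Lipschitz away from the origin. -/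
lemma abs_rayleigh_sub_le {E : Type*} [NormedAddCommGroup E] [InnerProductSpace ℝ E]
    (T : E →L[ℝ] E) (hT : ∀ u v, ⟪T u, v⟫ = ⟪u, T v⟫) {a x : E} (ha : a ≠ 0)
    (hax : ‖a‖ ≤ ‖x‖) :
    |⟪x, T x⟫ / ⟪x, x⟫ - ⟪a, T a⟫ / ⟪a, a⟫| ≤ 4 * ‖T‖ * ‖x - a‖ / ‖x‖ := by
  have ha' : 0 < ‖a‖ := norm_pos_iff.mpr ha
  have hx' : 0 < ‖x‖ := ha'.trans_le hax
  have hquad (u : E) : |⟪u, T u⟫| ≤ ‖T‖ * ‖u‖ ^ 2 := by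
    nlinarith [abs_real_inner_le_norm u (T u), T.le_opNorm u, norm_nonneg u]
  set μ := ⟪a, T a⟫ / ⟪a, a⟫ with hμ
  have hμa : ⟪a, T a⟫ = μ * ⟪a, a⟫ := by
    rw [hμ, div_mul_cancel₀ _ (inner_self_ne_zero.mpr ha)]
  have hμT : |μ| ≤ ‖T‖ := by
    rw [hμ, real_inner_self_eq_norm_sq, abs_div, abs_of_pos (pow_pos ha' 2),
      div_le_iff₀ (pow_pos ha' 2)]
    exact hquad a
  have hK (u : E) : ‖T u - μ • u‖ ≤ 2 * ‖T‖ * ‖u‖ := by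
    have h := norm_sub_le (T u) (μ • u)
    rw [norm_smul, Real.norm_eq_abs] at h
    nlinarith [T.le_opNorm u, mul_le_mul_of_nonneg_right hμT (norm_nonneg u)]
  have hsplit : ⟪x, T x⟫ - μ * ⟪x, x⟫ =
      ⟪x - a, T x - μ • x⟫ + ⟪x - a, T a - μ • a⟫ := by
    have h := hT a x
    rw [real_inner_comm] at h
    simp only [inner_sub_left, inner_sub_right, inner_smul_right]
    rw [real_inner_comm a x]
    linarith
  have hbound : |⟪x, T x⟫ - μ * ⟪x, x⟫| ≤ 4 * ‖T‖ * ‖x - a‖ * ‖x‖ := by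
    have hd := norm_nonneg (x - a)
    calc |⟪x, T x⟫ - μ * ⟪x, x⟫|
        ≤ |⟪x - a, T x - μ • x⟫| + |⟪x - a, T a - μ • a⟫| := hsplit ▸ abs_add_le _ _
      _ ≤ ‖x - a‖ * (2 * ‖T‖ * ‖x‖) + ‖x - a‖ * (2 * ‖T‖ * ‖a‖) :=
          add_le_add
            ((abs_real_inner_le_norm _ _).trans (mul_le_mul_of_nonneg_left (hK x) hd))
            ((abs_real_inner_le_norm _ _).trans (mul_le_mul_of_nonneg_left (hK a) hd))
      _ ≤ ‖x - a‖ * (2 * ‖T‖ * ‖x‖) + ‖x - a‖ * (2 * ‖T‖ * ‖x‖) := by gcongr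
      _ = 4 * ‖T‖ * ‖x - a‖ * ‖x‖ := by ring
  have hxx : ⟪x, x⟫ = ‖x‖ ^ 2 := real_inner_self_eq_norm_sq x
  rw [hxx] at hbound ⊢
  rw [div_sub' (by positivity), abs_div, abs_of_pos (pow_pos hx' 2),
    div_le_div_iff₀ (by positivity) hx', mul_comm (‖x‖ ^ 2) μ]
  nlinarith [mul_le_mul_of_nonneg_right hbound hx'.le]

/-- The Euclidean norm is at most the `ℓ1` norm. -/
lemma EuclideanSpace.norm_le_sum_abs {ι : Type*} [Fintype ι] (v : EuclideanSpace ℝ ι) :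
    ‖v‖ ≤ ∑ i, |v i| := by
  rw [EuclideanSpace.norm_eq]
  refine Real.sqrt_le_iff.mpr ⟨Finset.sum_nonneg fun i _ => abs_nonneg _, ?_⟩
  simpa only [Real.norm_eq_abs] using
    Finset.sum_sq_le_sq_sum_of_nonneg fun i (_ : i ∈ Finset.univ) => abs_nonneg (v i)

/-- Cauchy–Schwarz bound of the `ℓ1` norm of a vector supported in `s`. -/
lemma EuclideanSpace.sum_abs_le_sqrt_card_mul_norm {ι : Type*} [Fintype ι] (s : Finset ι)
    (v : EuclideanSpace ℝ ι) (hv : ∀ i ∉ s, v i = 0) :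
    ∑ i, |v i| ≤ √(s.card : ℝ) * ‖v‖ := by
  have hsum : ∑ i, |v i| = ∑ i ∈ s, |v i| :=
    (Finset.sum_subset s.subset_univ fun i _ hi => by simp [hv i hi]).symm
  rw [EuclideanSpace.norm_eq, ← Real.sqrt_mul (Nat.cast_nonneg _), hsum]
  refine Real.le_sqrt_of_sq_le ((sq_sum_le_card_mul_sum_sq).trans ?_)
  simp only [Real.norm_eq_abs]
  gcongr
  exact s.subset_univ

/-- ball lemma, deterministic form: with `H` symmetric, `‖H‖ ≤ F₀`,
`a, x` supported in `T₀` (of size `F₀`), `a ≠ 0`, the segment from `a` to `x`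
staying at norm `≥ ‖a‖₂`, `|F(a) − 1| ≤ ε/2`, and `‖x − a‖₁ ≤ ε‖a‖₁/(8·F₀^{3/2})`,
we have `|F(x) − 1| ≤ ε`, where `F(y) = yᵀHy/yᵀy`. -/
theorem ball_lemma (n : ℕ) (T₀ : Finset (Fin n)) (hT₀ : T₀.Nonempty)
    (F₀ : ℕ) (hF₀ : F₀ = T₀.card)
    (H : Matrix (Fin n) (Fin n) ℝ) (hsymm : H.IsSymm)
    (hnorm : ‖Matrix.toEuclideanCLM (𝕜 := ℝ) H‖ ≤ (F₀ : ℝ))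
    (a x : EuclideanSpace ℝ (Fin n))
    (ha0 : ∀ i ∉ T₀, a i = 0) (hx0 : ∀ i ∉ T₀, x i = 0)
    (hane : a ≠ 0)
    (hseg : ∀ c ∈ Set.Icc (0 : ℝ) 1, ‖a‖ ≤ ‖(1 - c) • a + c • x‖)
    (ε : ℝ) (hε0 : 0 < ε) (hε1 : ε < 1)
    (F : EuclideanSpace ℝ (Fin n) → ℝ)
    (hF : ∀ y, F y = ⟪y, Matrix.toEuclideanLin H y⟫ / ⟪y, y⟫)
    (haF : |F a - 1| ≤ ε / 2)
    (hball : ∑ i, |x i - a i| ≤ ε * (∑ i, |a i|) / (8 * (F₀ : ℝ) ^ ((3 : ℝ) / 2))) :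
    |F x - 1| ≤ ε := by
  have hF₀pos : (0 : ℝ) < F₀ := by
    rw [hF₀]
    exact_mod_cast hT₀.card_pos
  have hax : ‖a‖ ≤ ‖x‖ := by simpa using hseg 1 (by simp)
  have hxpos : 0 < ‖x‖ := (norm_pos_iff.mpr hane).trans_le hax
  have hpow : (F₀ : ℝ) ^ ((3 : ℝ) / 2) = F₀ * √(F₀ : ℝ) := by
    rw [Real.sqrt_eq_rpow, ← Real.rpow_one_add' hF₀pos.le (by norm_num)]
    norm_num
  have hdist : ‖x - a‖ ≤ ε * ‖x‖ / (8 * F₀) := by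
    have hsqrt : 0 < √(F₀ : ℝ) := Real.sqrt_pos.mpr hF₀pos
    calc ‖x - a‖ ≤ ∑ i, |x i - a i| := EuclideanSpace.norm_le_sum_abs (x - a)
      _ ≤ ε * (∑ i, |a i|) / (8 * (F₀ * √(F₀ : ℝ))) := hpow ▸ hball
      _ ≤ ε * (√(F₀ : ℝ) * ‖x‖) / (8 * (F₀ * √(F₀ : ℝ))) := by
          have h := EuclideanSpace.sum_abs_le_sqrt_card_mul_norm T₀ a ha0
          rw [← hF₀] at h
          have h' := h.trans (mul_le_mul_of_nonneg_left hax hsqrt.le)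
          gcongr
      _ = ε * ‖x‖ / (8 * F₀) := by field_simp
  have hself (u v : EuclideanSpace ℝ (Fin n)) :
      ⟪Matrix.toEuclideanCLM (𝕜 := ℝ) H u, v⟫ = ⟪u, Matrix.toEuclideanCLM (𝕜 := ℝ) H v⟫ :=
    Matrix.isSymmetric_toEuclideanLin_iff.mpr
      ((Matrix.conjTranspose_eq_transpose_of_trivial H).trans hsymm) u v
  have hdiff : |F x - F a| ≤ ε / 2 := by
    rw [hF, hF]
    calc _ ≤ 4 * ‖Matrix.toEuclideanCLM (𝕜 := ℝ) H‖ * ‖x - a‖ / ‖x‖ :=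
          abs_rayleigh_sub_le (Matrix.toEuclideanCLM (𝕜 := ℝ) H) hself hane hax
      _ ≤ 4 * F₀ * (ε * ‖x‖ / (8 * F₀)) / ‖x‖ := by gcongr
      _ = ε / 2 := by
          field_simp
          norm_num
  calc |F x - 1| ≤ |F x - F a| + |F a - 1| := abs_sub_le _ _ _
    _ ≤ ε := by linarith
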